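/- Let A be a commutative Noetherian ring, let n ∈ ℕ, and let 0 → M → M_0 → M_1 → ⋯ → M_r → 0 be an exact sequence of finitely generated A-modules. Assume that for each i = 0, …, r the module M_i satisfies Serre's condition S_{n−i}, and that dim (M_i)_𝔭 ≥ dim (M_0)_𝔭 − i for every i and every prime ideal 𝔭 of A. Then M satisfies Serre's condition S_n. Furthermore, if M_0 is torsion-free, then so is M. -/

import Mathlib

open RingTheory

/-- The depth of a module `N` over a (Noetherian) local ring `A`: the supremum of the
lengths of (weakly) regular sequences on `N` consisting of elements of the maximal
ideal, with the convention that the depth of the zero module is `+∞`. -/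
noncomputable def moduleDepth (A : Type u) [CommRing A] [IsLocalRing A]
    (N : Type v) [AddCommGroup N] [Module A N] : ℕ∞ :=
  open Classical in
  if Subsingleton N then ⊤
  else sSup {n : ℕ∞ | ∃ rs : List A, (rs.length : ℕ∞) = n ∧
    (∀ r ∈ rs, r ∈ IsLocalRing.maximalIdeal A) ∧ RingTheory.Sequence.IsWeaklyRegular N rs}

/-- The dimension of a module `N` over a commutative ring `A`: the Krull dimension of
its support in `Spec A` (which is `⊥` for the zero module). -/
noncomputable def moduleDim (A : Type u) [CommRing A]
    (N : Type v) [AddCommGroup N] [Module A N] : WithBot ℕ∞ :=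
  Order.krullDim (Module.support A N)

/-- The depth of the localization `N_𝔭` over `A_𝔭`. -/
noncomputable def localizedDepth (A : Type u) [CommRing A] (𝔭 : PrimeSpectrum A)
    (N : Type v) [AddCommGroup N] [Module A N] : ℕ∞ :=
  moduleDepth (Localization.AtPrime 𝔭.asIdeal) (LocalizedModule 𝔭.asIdeal.primeCompl N)

/-- The dimension of the localization `N_𝔭` over `A_𝔭`. -/
noncomputable def localizedDim (A : Type u) [CommRing A] (𝔭 : PrimeSpectrum A)
    (N : Type v) [AddCommGroup N] [Module A N] : WithBot ℕ∞ :=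
  moduleDim (Localization.AtPrime 𝔭.asIdeal) (LocalizedModule 𝔭.asIdeal.primeCompl N)

/-- Serre's condition `S_n` for a module `N` over a commutative ring `A`:
`depth_{A_𝔭} N_𝔭 ≥ min(n, dim N_𝔭)` for every prime ideal `𝔭` of `A`. -/
def SerreCondition (n : ℕ) (A : Type u) [CommRing A]
    (N : Type v) [AddCommGroup N] [Module A N] : Prop :=
  ∀ 𝔭 : PrimeSpectrum A,
    min (n : WithBot ℕ∞) (localizedDim A 𝔭 N) ≤ (localizedDepth A 𝔭 N : WithBot ℕ∞)

/-- A module `N` over `A` is torsion-free if every nonzerodivisor of `A` acts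
injectively on `N`. -/
def IsTorsionFreeModule (A : Type u) [CommRing A]
    (N : Type v) [AddCommGroup N] [Module A N] : Prop :=
  ∀ a ∈ nonZeroDivisors A, Function.Injective fun x : N => a • x

open CategoryTheory Abelian IsLocalRing in
/-- Rees' characterization of depth over a Noetherian local ring, including the zero module. -/
lemma le_moduleDepth_iff_subsingleton_ext {R : Type u} [CommRing R] [IsLocalRing R]
    [IsNoetherianRing R] [Small.{w} R] (N : Type w) [AddCommGroup N] [Module R N]
    [Module.Finite R N] (k : ℕ) :
    (k : ℕ∞) ≤ moduleDepth R N ↔ ∀ i < k, Subsingleton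
      (Ext (ModuleCat.of R (Shrink.{w} (R ⧸ maximalIdeal R))) (ModuleCat.of R N) i) := by
  rcases subsingleton_or_nontrivial N with h | h
  · have hz : Limits.IsZero (ModuleCat.of R N) := ModuleCat.isZero_of_subsingleton _
    simp only [moduleDepth, h, if_true, le_top, true_iff]
    have hid : Ext.mk₀ (𝟙 (ModuleCat.of R N)) = 0 := by
      rw [hz.eq_zero_of_src (𝟙 _), Ext.mk₀_zero]
    have hzero {X : ModuleCat R} {i : ℕ} (x : Ext X (ModuleCat.of R N) i) : x = 0 := by
      rw [← Ext.comp_mk₀_id x, hid, Ext.comp_zero]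
    exact fun i _ => ⟨fun x y => (hzero x).trans (hzero y).symm⟩
  · have hlt : maximalIdeal R • (⊤ : Submodule R (ModuleCat.of R N)) < ⊤ :=
      lt_top_iff_ne_top.mpr (Submodule.top_ne_ideal_smul_of_le_jacobson_annihilator
        (maximalIdeal_le_jacobson _)).symm
    have htfae := fun k => ModuleCat.exists_isRegular_tfae (maximalIdeal R) k
      (ModuleCat.of R N) hlt
    simp only [moduleDepth, not_subsingleton, if_false]
    constructor
    · intro hk i hi
      obtain ⟨_, ⟨rs, rfl, hmem, hreg⟩, hlt⟩ := lt_sSup_iff.mp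
        ((Nat.cast_lt (α := ℕ∞).mpr hi).trans_le hk)
      have h31 := (htfae rs.length).out 3 1
      exact h31.mp ⟨rs, rfl, hmem, .of_isWeaklyRegular_of_mem_maximalIdeal N hmem hreg⟩ i
        (by exact_mod_cast hlt)
    · intro hext
      obtain ⟨rs, hlen, hmem, hreg⟩ := ((htfae k).out 1 3).mp hext
      exact le_sSup ⟨rs, by rw [hlen], hmem, hreg.toIsWeaklyRegular⟩

open CategoryTheory Abelian in
/-- The depth lemma for a short exact sequence `0 → M → N → C → 0`. -/
lemma le_moduleDepth_of_shortExact {R : Type u} [CommRing R] [IsLocalRing R]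
    [IsNoetherianRing R] [Small.{w} R] {M N C : Type w} [AddCommGroup M] [Module R M]
    [Module.Finite R M] [AddCommGroup N] [Module R N] [Module.Finite R N] [AddCommGroup C]
    [Module R C] [Module.Finite R C] {f : M →ₗ[R] N} {g : N →ₗ[R] C}
    (hf : Function.Injective f) (hfg : Function.Exact f g) (hg : Function.Surjective g)
    {k : ℕ} (hN : ((k + 1 : ℕ) : ℕ∞) ≤ moduleDepth R N) (hC : (k : ℕ∞) ≤ moduleDepth R C) :
    ((k + 1 : ℕ) : ℕ∞) ≤ moduleDepth R M := by
  rw [le_moduleDepth_iff_subsingleton_ext] at hN hC ⊢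
  have hSE : (ShortComplex.mk (ModuleCat.ofHom f) (ModuleCat.ofHom g)
      (by ext x; exact hfg.apply_apply_eq_zero x)).ShortExact :=
    { exact := (ShortComplex.ShortExact.moduleCat_exact_iff_function_exact _).mpr hfg
      mono_f := (ModuleCat.mono_iff_injective _).mpr hf
      epi_g := (ModuleCat.epi_iff_surjective _).mpr hg }
  intro i hi
  have hN' := AddCommGrpCat.isZero_of_iff_subsingleton.mpr (hN i hi)
  cases i with
  | zero =>
    have := hSE.mono_f
    have := hN 0 hi
    exact (Ext.postcomp_mk₀_injective_of_mono _ (ModuleCat.ofHom f)).subsingleton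
  | succ i =>
    have hC' := AddCommGrpCat.isZero_of_iff_subsingleton.mpr (hC i (by omega))
    exact AddCommGrpCat.subsingleton_of_isZero <| ShortComplex.Exact.isZero_of_both_zeros
      (Ext.covariant_sequence_exact₁' _ hSE i (i + 1) rfl)
      (hC'.eq_zero_of_src _) (hN'.eq_zero_of_tgt _)

/-- The depth lemma for an exact sequence `0 → M → N 0 → N 1 → ⋯`. -/
lemma le_moduleDepth_of_longExact {R : Type u} [CommRing R] [IsLocalRing R]
    [IsNoetherianRing R] [Small.{w} R] (k : ℕ) {M : Type w} [AddCommGroup M] [Module R M]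
    [Module.Finite R M] (N : ℕ → Type w) [∀ i, AddCommGroup (N i)] [∀ i, Module R (N i)]
    [∀ i, Module.Finite R (N i)] (f : M →ₗ[R] N 0) (g : ∀ i, N i →ₗ[R] N (i + 1))
    (hf : Function.Injective f) (hex₀ : Function.Exact f (g 0))
    (hex : ∀ i, Function.Exact (g i) (g (i + 1)))
    (hN : ∀ i, ((k - i : ℕ) : ℕ∞) ≤ moduleDepth R (N i)) :
    (k : ℕ∞) ≤ moduleDepth R M := by
  induction k generalizing M N with
  | zero => simp
  | succ k ih =>
    refine le_moduleDepth_of_shortExact (g := (g 0).rangeRestrict) hf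
      (fun x => by rw [← hex₀ x, Subtype.ext_iff]; rfl) (g 0).surjective_rangeRestrict (hN 0) ?_
    refine ih (fun i => N (i + 1)) (g 0).range.subtype (fun i => g (i + 1))
      (Submodule.subtype_injective _) (fun x => ?_) (fun i => hex (i + 1)) (fun i => ?_)
    · rw [hex 0 x]
      simp
    · simpa using hN (i + 1)

/--
Let `A` be a commutative Noetherian ring, `n ∈ ℕ`, and
`0 → M → N 0 → N 1 → ⋯ → N r → 0` an exact sequence of finitely generated `A`-modules
(the modules `N i` for `i > r` being zero).  Assume that each `N i` (for `i ≤ r`)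
satisfies Serre's condition `S_{n−i}` and that `dim (N i)_𝔭 ≥ dim (N 0)_𝔭 − i` for every
`i ≤ r` and every prime `𝔭` of `A`.  Then `M` satisfies `S_n`; furthermore, if `N 0` is
torsion-free then so is `M`.
-/
theorem serre_condition_of_longExact
    {A : Type u} [CommRing A] [IsNoetherianRing A] (n r : ℕ)
    {M : Type v} [AddCommGroup M] [Module A M] [Module.Finite A M]
    (N : ℕ → Type v) [∀ i, AddCommGroup (N i)] [∀ i, Module A (N i)]
    [∀ i, Module.Finite A (N i)]
    (f : M →ₗ[A] N 0) (g : ∀ i : ℕ, N i →ₗ[A] N (i + 1))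
    (hf : Function.Injective f)
    (hex₀ : Function.Exact f (g 0))
    (hex : ∀ i : ℕ, Function.Exact (g i) (g (i + 1)))
    (htail : ∀ i : ℕ, r < i → Subsingleton (N i))
    (hS : ∀ i : ℕ, i ≤ r → SerreCondition (n - i) A (N i))
    (hdim : ∀ i : ℕ, i ≤ r → ∀ 𝔭 : PrimeSpectrum A,
      localizedDim A 𝔭 (N 0) ≤ localizedDim A 𝔭 (N i) + (i : WithBot ℕ∞)) :
    SerreCondition n A M ∧
      (IsTorsionFreeModule A (N 0) → IsTorsionFreeModule A M) := by
  refine ⟨fun 𝔭 => ?_, fun h a ha x y hxy => hf (h a ha ?_)⟩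
  · set S := 𝔭.asIdeal.primeCompl
    have hfS := IsLocalizedModule.map_injective S (LocalizedModule.mkLinearMap S M)
      (LocalizedModule.mkLinearMap S (N 0)) f hf
    have hdimM : localizedDim A 𝔭 M ≤ localizedDim A 𝔭 (N 0) :=
      Module.supportDim_le_of_injective (LocalizedModule.map S f) hfS
    obtain ⟨k, hk⟩ | hbot : (∃ k : ℕ, min (n : WithBot ℕ∞) (localizedDim A 𝔭 M) = k) ∨
        min (n : WithBot ℕ∞) (localizedDim A 𝔭 M) = ⊥ := by
      generalize localizedDim A 𝔭 M = d
      induction d with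
      | bot => simp
      | coe d =>
        induction d with
        | top => exact .inl ⟨n, min_eq_left le_top⟩
        | coe d => exact .inl ⟨min n d, by norm_cast⟩
    swap
    · simp [hbot]
    rw [hk]
    have hkn : k ≤ n := by
      exact_mod_cast hk.symm.trans_le (min_le_left _ _)
    have hkd : (k : WithBot ℕ∞) ≤ localizedDim A 𝔭 (N 0) :=
      (hk.symm.trans_le (min_le_right _ _)).trans hdimM
    have : (k : ℕ∞) ≤ localizedDepth A 𝔭 M := by
      refine le_moduleDepth_of_longExact k (fun i => LocalizedModule S (N i))
        (LocalizedModule.map S f) (fun i => LocalizedModule.map S (g i)) hfS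
        (LocalizedModule.map_exact S f (g 0) hex₀)
        (fun i => LocalizedModule.map_exact S (g i) (g (i + 1)) (hex i)) (fun i => ?_)
      rcases lt_or_ge r i with hi | hi
      · have := htail i hi
        have : Subsingleton (LocalizedModule S (N i)) := inferInstance
        simp [moduleDepth, this]
      · have hle := hkd.trans (hdim i hi 𝔭)
        have hkdi : ((k - i : ℕ) : WithBot ℕ∞) ≤ localizedDim A 𝔭 (N i) := by
          generalize localizedDim A 𝔭 (N i) = d at hle
          induction d with
          | bot => simp at hle
          | coe d =>
            induction d with
            | top => exact le_top
            | coe d =>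
              norm_cast at hle
              exact WithBot.coe_le_coe.mpr (Nat.cast_le.mpr (Nat.sub_le_iff_le_add.mpr hle))
        have hkni : ((k - i : ℕ) : WithBot ℕ∞) ≤ ((n - i : ℕ) : WithBot ℕ∞) := by
          exact_mod_cast Nat.sub_le_sub_right hkn i
        have := (le_min hkni hkdi).trans (hS i hi 𝔭)
        exact WithBot.coe_le_coe.mp this
    exact_mod_cast this
  · simpa using congrArg f hxy
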